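/- Let ν be a probability measure on [0,1], let f : [0,1] → ℝ be nonnegative and nondecreasing, and let g : [0,1] → ℝ be nondecreasing, concave, and satisfy g(0) ≥ 0. Let κ be a Markov kernel from [0,1] to [0,1] whose barycenter map β(q) = ∫ a dκ_q(a) is nondecreasing in q and satisfies ∫ β(q) dν(q) = m for some m ∈ (0,1]. Then ∫ f(q)·(∫ g(a) dκ_q(a)) dν(q) ≥ m·g(1)·∫ f(q) dν(q). Since the welfare of every Markov kernel from [0,1] to [0,1] is at most g(1)·∫ f dν, the efficiency loss is at most a factor of 1/m (where m is the average student ability). -/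

import Mathlib

open MeasureTheory Set ProbabilityTheory

/-- A function that is monotone on `[0,1]` agrees there with a globally monotone function whose
values lie between those at `0` and `1`. -/
theorem MonotoneOn.exists_monotone_bounded_extension {f : ℝ → ℝ}
    (hf : MonotoneOn f (Icc (0:ℝ) 1)) :
    ∃ F : ℝ → ℝ, Monotone F ∧ (∀ x ∈ Icc (0:ℝ) 1, F x = f x) ∧
      ∀ x, F x ∈ Icc (f 0) (f 1) := by
  have hp : ∀ x : ℝ, max 0 (min 1 x) ∈ Icc (0:ℝ) 1 := fun x =>
    ⟨le_max_left _ _, max_le zero_le_one (min_le_left _ _)⟩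
  refine ⟨fun x => f (max 0 (min 1 x)), fun x y hxy => hf (hp x) (hp y) (by gcongr),
    fun x hx => ?_, fun x => ⟨hf (by simp) (hp x) (hp x).1, hf (hp x) (by simp) (hp x).2⟩⟩
  simp [hx.1, hx.2]

/-- A function monotone on `[0,1]` is integrable for any finite measure carried by `[0,1]`. -/
theorem MonotoneOn.integrable_of_ae_mem_Icc {f : ℝ → ℝ} (hf : MonotoneOn f (Icc (0:ℝ) 1))
    {μ : Measure ℝ} [IsFiniteMeasure μ] (hμ : ∀ᵐ x ∂μ, x ∈ Icc (0:ℝ) 1) :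
    Integrable f μ := by
  obtain ⟨F, hF, hFf, hFb⟩ := hf.exists_monotone_bounded_extension
  have hFi : Integrable F μ :=
    Integrable.of_mem_Icc (f 0) (f 1) hF.measurable.aemeasurable (ae_of_all _ hFb)
  exact hFi.congr (hμ.mono hFf)

/-- The product of two functions monotone on `[0,1]` is integrable for any finite measure carried
by `[0,1]`. -/
theorem MonotoneOn.integrable_mul_of_ae_mem_Icc {f b : ℝ → ℝ}
    (hf : MonotoneOn f (Icc (0:ℝ) 1)) (hb : MonotoneOn b (Icc (0:ℝ) 1))
    {μ : Measure ℝ} [IsFiniteMeasure μ] (hμ : ∀ᵐ x ∂μ, x ∈ Icc (0:ℝ) 1) :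
    Integrable (fun x => f x * b x) μ := by
  refine (hb.integrable_of_ae_mem_Icc hμ).bdd_mul (c := max |f 0| |f 1|)
    (hf.integrable_of_ae_mem_Icc hμ).aestronglyMeasurable (hμ.mono fun x hx => ?_)
  exact abs_le_max_abs_abs (hf (by simp) hx hx.1) (hf hx (by simp) hx.2)

/-- Chebyshev's association inequality for a probability measure carried by `[0,1]`. -/
theorem MonotoneOn.integral_mul_integral_le {f b : ℝ → ℝ}
    (hf : MonotoneOn f (Icc (0:ℝ) 1)) (hb : MonotoneOn b (Icc (0:ℝ) 1))
    {μ : Measure ℝ} [IsProbabilityMeasure μ] (hμ : ∀ᵐ x ∂μ, x ∈ Icc (0:ℝ) 1) :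
    (∫ x, f x ∂μ) * (∫ x, b x ∂μ) ≤ ∫ x, f x * b x ∂μ := by
  have hfi := hf.integrable_of_ae_mem_Icc hμ
  have hbi := hb.integrable_of_ae_mem_Icc hμ
  have hfb := hf.integrable_mul_of_ae_mem_Icc hb hμ
  have inner : ∀ x ∈ Icc (0:ℝ) 1, f x * (∫ y, b y ∂μ) + b x * (∫ y, f y ∂μ)
      ≤ f x * b x + ∫ y, f y * b y ∂μ := by
    intro x hx
    have h : ∫ y, (f x * b y + b x * f y) ∂μ ≤ ∫ y, (f x * b x + f y * b y) ∂μ := by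
      refine integral_mono_ae ((hbi.const_mul _).add (hfi.const_mul _))
        ((integrable_const _).add hfb) (hμ.mono fun y hy => ?_)
      dsimp only
      rcases le_total x y with hxy | hxy
      · nlinarith [mul_nonneg (sub_nonneg.2 (hf hx hy hxy)) (sub_nonneg.2 (hb hx hy hxy))]
      · nlinarith [mul_nonneg (sub_nonneg.2 (hf hy hx hxy)) (sub_nonneg.2 (hb hy hx hxy))]
    rw [integral_add (hbi.const_mul _) (hfi.const_mul _), integral_add (integrable_const _) hfb,
      integral_const_mul, integral_const_mul] at h
    simpa using h
  have outer := integral_mono_ae ((hfi.mul_const _).add (hbi.mul_const _))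
    (hfb.add (integrable_const _)) (hμ.mono inner)
  simp only [Pi.add_apply] at outer
  rw [integral_add (hfi.mul_const _) (hbi.mul_const _), integral_add hfb (integrable_const _),
    integral_mul_const, integral_mul_const] at outer
  simp only [integral_const, probReal_univ, one_smul] at outer
  linarith

/-- A concave function on `[0,1]` that is nonnegative at `0` lies above the line through the
origin and its value at `1`. -/
theorem ConcaveOn.mul_apply_one_le {g : ℝ → ℝ} (hg : ConcaveOn ℝ (Icc (0:ℝ) 1) g)
    (hg0 : 0 ≤ g 0) {a : ℝ} (ha : a ∈ Icc (0:ℝ) 1) : a * g 1 ≤ g a := by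
  have h := hg.2 (x := 0) (by simp) (y := 1) (by simp) (sub_nonneg.2 ha.2) ha.1
    (sub_add_cancel 1 a)
  simp only [smul_eq_mul, mul_zero, mul_one, zero_add] at h
  nlinarith [mul_nonneg (sub_nonneg.2 ha.2) hg0]

/-- For any assignment of students to jobs (a Markov kernel `κ` from job qualities in
`[0,1]` to student abilities in `[0,1]`) whose barycenter map is nondecreasing and has
`ν`-average `m ∈ (0,1]`, the social welfare is at least `m * g 1 * ∫ f dν`; since every
assignment has welfare at most `g 1 * ∫ f dν`, the efficiency loss is at most `1/m`. -/
theorem stmt_3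
    (ν : Measure ℝ) [IsProbabilityMeasure ν] (hν : ν (Set.Icc (0:ℝ) 1)ᶜ = 0)
    (f g : ℝ → ℝ)
    (hf0 : ∀ q ∈ Set.Icc (0:ℝ) 1, 0 ≤ f q)
    (hfmono : MonotoneOn f (Set.Icc (0:ℝ) 1))
    (hgmono : MonotoneOn g (Set.Icc (0:ℝ) 1))
    (hgconc : ConcaveOn ℝ (Set.Icc (0:ℝ) 1) g)
    (hg0 : 0 ≤ g 0)
    (κ : Kernel ℝ ℝ) [IsMarkovKernel κ]
    (hκsupp : ∀ q ∈ Set.Icc (0:ℝ) 1, (κ q) (Set.Icc (0:ℝ) 1)ᶜ = 0)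
    (hβmono : MonotoneOn (fun q => ∫ a, a ∂(κ q)) (Set.Icc (0:ℝ) 1))
    (m : ℝ) (hm : m ∈ Set.Ioc (0:ℝ) 1)
    (hβavg : ∫ q, (∫ a, a ∂(κ q)) ∂ν = m) :
    m * g 1 * (∫ q, f q ∂ν) ≤ ∫ q, f q * (∫ a, g a ∂(κ q)) ∂ν := by
  have hνI : ∀ᵐ q ∂ν, q ∈ Icc (0:ℝ) 1 := hν
  have hκI : ∀ q ∈ Icc (0:ℝ) 1, ∀ᵐ a ∂(κ q), a ∈ Icc (0:ℝ) 1 := hκsupp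
  have hg1 : 0 ≤ g 1 := hg0.trans (hgmono (by simp) (by simp) zero_le_one)
  have hfi := hfmono.integrable_of_ae_mem_Icc hνI
  obtain ⟨G, hG, hGg, hGb⟩ := hgmono.exists_monotone_bounded_extension
  have hGint : ∀ q ∈ Icc (0:ℝ) 1, ∫ a, G a ∂(κ q) = ∫ a, g a ∂(κ q) := fun q hq =>
    integral_congr_ae ((hκI q hq).mono hGg)
  have hGmeas : StronglyMeasurable fun q => ∫ a, G a ∂(κ q) :=
    hG.measurable.stronglyMeasurable.integral_kernel
  have hwelfare : Integrable (fun q => f q * ∫ a, g a ∂(κ q)) ν := by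
    have hb : Integrable (fun q => f q * ∫ a, G a ∂(κ q)) ν := by
      refine hfi.mul_bdd (c := g 1) hGmeas.aestronglyMeasurable (ae_of_all _ fun q => ?_)
      refine (norm_integral_le_of_norm_le_const (C := g 1) (ae_of_all _ fun a => ?_)).trans
        (by simp)
      rw [Real.norm_of_nonneg (hg0.trans (hGb a).1)]
      exact (hGb a).2
    refine hb.congr (hνI.mono fun q hq => ?_)
    simp only [hGint q hq]
  have hpoint : ∀ q ∈ Icc (0:ℝ) 1, g 1 * (∫ a, a ∂(κ q)) ≤ ∫ a, g a ∂(κ q) := by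
    intro q hq
    have hid : Integrable (fun a : ℝ => a) (κ q) :=
      (monotone_id.monotoneOn _).integrable_of_ae_mem_Icc (hκI q hq)
    rw [mul_comm, ← integral_mul_const]
    exact integral_mono_ae (hid.mul_const _) (hgmono.integrable_of_ae_mem_Icc (hκI q hq))
      ((hκI q hq).mono fun a ha => hgconc.mul_apply_one_le hg0 ha)
  have hcheb := hfmono.integral_mul_integral_le hβmono hνI
  rw [hβavg] at hcheb
  calc m * g 1 * (∫ q, f q ∂ν) = g 1 * ((∫ q, f q ∂ν) * m) := by ring
    _ ≤ g 1 * ∫ q, f q * (∫ a, a ∂(κ q)) ∂ν := by gcongr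
    _ = ∫ q, g 1 * (f q * ∫ a, a ∂(κ q)) ∂ν := (integral_const_mul _ _).symm
    _ ≤ ∫ q, f q * (∫ a, g a ∂(κ q)) ∂ν := by
      refine integral_mono_ae
        ((hfmono.integrable_mul_of_ae_mem_Icc hβmono hνI).const_mul _) hwelfare
        (hνI.mono fun q hq => ?_)
      have h := mul_le_mul_of_nonneg_left (hpoint q hq) (hf0 q hq)
      dsimp only
      linarith
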